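/- arXiv:1809.00752 — 8 statements merged into one kernel-verified Lean document; each statement's English description precedes it below -/
import Mathlib

section
/- Suppose the channel matrix Φ has rank m. Then the capacity-achieving input distribution is unique: there is exactly one λ* ∈ Δ(X) with I(λ*,Φ) = C. (Lemma 1) -/
open scoped BigOperators

noncomputable section

/-- The simplex of probability vectors on `Fin m`. -/
def chSimplex (m : ℕ) : Set (Fin m → ℝ) :=
  {l | (∀ i, 0 ≤ l i) ∧ ∑ i, l i = 1}

/-- The output distribution `λΦ` of the channel `P` for input distribution `l`. -/
def chOut {m n : ℕ} (P : Matrix (Fin m) (Fin n) ℝ) (l : Fin m → ℝ) (j : Fin n) : ℝ :=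
  ∑ i, l i * P i j

/-- Kullback-Leibler divergence `D(Q‖Q')`. -/
def chKL {n : ℕ} (Q Q' : Fin n → ℝ) : ℝ :=
  ∑ j, Q j * Real.log (Q j / Q' j)

/-- Mutual information `I(λ,Φ)`. -/
def chMI {m n : ℕ} (P : Matrix (Fin m) (Fin n) ℝ) (l : Fin m → ℝ) : ℝ :=
  ∑ i, ∑ j, l i * P i j * Real.log (P i j / chOut P l j)

/-- The Arimoto map `F(λ)`, componentwise. -/
def chAF {m n : ℕ} (P : Matrix (Fin m) (Fin n) ℝ) (l : Fin m → ℝ) (i : Fin m) : ℝ :=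
  l i * Real.exp (chKL (P i) (chOut P l)) /
    ∑ k, l k * Real.exp (chKL (P k) (chOut P l))

/-- Partial derivative `∂f/∂λ_{i'}` at `x`, treating the coordinates as
independent variables. -/
def chPd {m : ℕ} (f : (Fin m → ℝ) → ℝ) (i' : Fin m) (x : Fin m → ℝ) : ℝ :=
  fderiv ℝ f x (Pi.single i' 1)

/-- Second partial derivative `∂²f/∂λ_{i'}∂λ_{i''}` at `x`. -/
def chPd2 {m : ℕ} (f : (Fin m → ℝ) → ℝ) (i' i'' : Fin m) (x : Fin m → ℝ) : ℝ :=
  chPd (chPd f i'') i' x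

/-- Mutual information as a linear term plus the entropy of the output distribution. -/
lemma chMI_eq_add_sum_negMulLog {m n : ℕ} {P : Matrix (Fin m) (Fin n) ℝ}
    (hP : ∀ i j, 0 ≤ P i j) {l : Fin m → ℝ} (hl : ∀ i, 0 ≤ l i) :
    chMI P l = ∑ i, l i * ∑ j, P i j * Real.log (P i j) +
      ∑ j, Real.negMulLog (chOut P l j) := by
  have hterm : ∀ i j, l i * P i j * Real.log (P i j / chOut P l j) =
      l i * (P i j * Real.log (P i j)) + -(l i * P i j * Real.log (chOut P l j)) := by
    intro i j
    by_cases h : l i * P i j = 0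
    · rw [← mul_assoc, h]
      simp
    · have hpos : 0 < l i * P i j := lt_of_le_of_ne (mul_nonneg (hl i) (hP i j)) (Ne.symm h)
      have hle : l i * P i j ≤ chOut P l j :=
        Finset.single_le_sum (f := fun k => l k * P k j)
          (fun k _ => mul_nonneg (hl k) (hP k j)) (Finset.mem_univ i)
      rw [Real.log_div (right_ne_zero_of_mul h) (hpos.trans_le hle).ne']
      ring
  simp only [chMI, hterm, Finset.sum_add_distrib, Finset.mul_sum]
  congr 1
  rw [Finset.sum_comm]
  refine Finset.sum_congr rfl fun j _ => ?_
  rw [Finset.sum_neg_distrib, ← Finset.sum_mul, Real.negMulLog, chOut, neg_mul]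

lemma chOut_injective_of_rank_eq {m n : ℕ} {P : Matrix (Fin m) (Fin n) ℝ}
    (h : P.rank = m) : Function.Injective (chOut P) := by
  have hrow : LinearIndependent ℝ P.row := by
    rw [linearIndependent_iff_card_eq_finrank_span, Fintype.card_fin, Set.finrank,
      ← Matrix.rank_eq_finrank_span_row, h]
  exact Matrix.vecMul_injective_iff.mpr hrow

lemma convex_chSimplex (m : ℕ) : Convex ℝ (chSimplex m) := convex_stdSimplex ℝ (Fin m)

lemma strictConcaveOn_chMI {m n : ℕ} {P : Matrix (Fin m) (Fin n) ℝ}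
    (hP : ∀ i j, 0 ≤ P i j) (hrank : P.rank = m) :
    StrictConcaveOn ℝ (chSimplex m) (chMI P) := by
  refine ⟨convex_chSimplex m, fun x hx y hy hxy a b ha hb hab => ?_⟩
  have hz := convex_chSimplex m hx hy ha.le hb.le hab
  have hout : ∀ j, chOut P (a • x + b • y) j = a • chOut P x j + b • chOut P y j := by
    intro j
    simp only [chOut, Pi.add_apply, Pi.smul_apply, smul_eq_mul, Finset.mul_sum,
      ← Finset.sum_add_distrib]
    exact Finset.sum_congr rfl fun i _ => by ring
  have hnn : ∀ l ∈ chSimplex m, ∀ j, chOut P l j ∈ Set.Ici (0 : ℝ) := fun l hl j =>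
    Finset.sum_nonneg fun i _ => mul_nonneg (hl.1 i) (hP i j)
  obtain ⟨k, hk⟩ := Function.ne_iff.mp ((chOut_injective_of_rank_eq hrank).ne hxy)
  have hlt : ∑ j, (a • Real.negMulLog (chOut P x j) + b • Real.negMulLog (chOut P y j)) <
      ∑ j, Real.negMulLog (chOut P (a • x + b • y) j) := by
    simp only [hout]
    exact Finset.sum_lt_sum
      (fun j _ => Real.concaveOn_negMulLog.2 (hnn x hx j) (hnn y hy j) ha.le hb.le hab)
      ⟨k, Finset.mem_univ k,
        Real.strictConcaveOn_negMulLog.2 (hnn x hx k) (hnn y hy k) hk ha hb hab⟩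
  have hlin : ∑ i, (a • x + b • y) i * ∑ j, P i j * Real.log (P i j) =
      a * ∑ i, x i * ∑ j, P i j * Real.log (P i j) +
        b * ∑ i, y i * ∑ j, P i j * Real.log (P i j) := by
    rw [Finset.mul_sum, Finset.mul_sum, ← Finset.sum_add_distrib]
    refine Finset.sum_congr rfl fun i _ => ?_
    simp only [Pi.add_apply, Pi.smul_apply, smul_eq_mul]
    ring
  rw [chMI_eq_add_sum_negMulLog hP hx.1, chMI_eq_add_sum_negMulLog hP hy.1,
    chMI_eq_add_sum_negMulLog hP hz.1, hlin]
  simp only [smul_eq_mul, Finset.sum_add_distrib, ← Finset.mul_sum] at hlt ⊢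
  linarith

/-- **Lemma 1.** If the channel matrix has rank `m`, the capacity-achieving
input distribution is unique. -/
theorem stmt_0 (m n : ℕ) (P : Matrix (Fin m) (Fin n) ℝ)
    (hPnn : ∀ i j, 0 ≤ P i j) (hProw : ∀ i, ∑ j, P i j = 1)
    (hPcol : ∀ j, ∃ i, 0 < P i j)
    (hrank : P.rank = m)
    (C : ℝ) (hC : IsGreatest (chMI P '' chSimplex m) C) :
    ∃! l : Fin m → ℝ, l ∈ chSimplex m ∧ chMI P l = C := by
  obtain ⟨⟨l, hl, hlC⟩, hmax⟩ := hC
  have hmaxOn : ∀ x, x ∈ chSimplex m ∧ chMI P x = C → IsMaxOn (chMI P) (chSimplex m) x := by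
    rintro x ⟨-, hx⟩ y hy
    exact (hmax ⟨y, hy, rfl⟩).trans hx.ge
  refine ⟨l, ⟨hl, hlC⟩, fun x hx => ?_⟩
  exact (strictConcaveOn_chMI hPnn hrank).eq_of_isMaxOn (hmaxOn x hx) (hmaxOn l ⟨hl, hlC⟩) hx.1 hl
end
end

section
/- If λ* ∈ Δ(X) achieves the channel capacity, then λ* is a fixed point of the Arimoto map: F(λ*) = λ*. (Lemma 2) -/
open scoped BigOperators

noncomputable section

theorem chMI_eq_sum_chKL {m n : ℕ} (P : Matrix (Fin m) (Fin n) ℝ) (l : Fin m → ℝ) :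
    chMI P l = ∑ i, l i * chKL (P i) (chOut P l) := by
  simp only [chMI, chKL, Finset.mul_sum, mul_assoc]

theorem chOut_nonneg {m n : ℕ} {P : Matrix (Fin m) (Fin n) ℝ} (hP : ∀ i j, 0 ≤ P i j)
    {l : Fin m → ℝ} (hl : ∀ i, 0 ≤ l i) (j : Fin n) : 0 ≤ chOut P l j :=
  Finset.sum_nonneg fun i _ => mul_nonneg (hl i) (hP i j)

theorem chOut_pos {m n : ℕ} {P : Matrix (Fin m) (Fin n) ℝ} (hP : ∀ i j, 0 ≤ P i j)
    {l : Fin m → ℝ} (hl : ∀ i, 0 ≤ l i) {i : Fin m} {j : Fin n} (hi : 0 < l i)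
    (hij : 0 < P i j) : 0 < chOut P l j :=
  Finset.sum_pos' (fun k _ => mul_nonneg (hl k) (hP k j)) ⟨i, Finset.mem_univ i, mul_pos hi hij⟩

/-- Reweighting the input distribution by `r`: a consequence of the log-sum inequality. -/
theorem sum_mul_chKL_sub_log_le_chMI {m n : ℕ} {P : Matrix (Fin m) (Fin n) ℝ}
    (hP : ∀ i j, 0 ≤ P i j) (hrow : ∀ i, ∑ j, P i j = 1) {l r : Fin m → ℝ}
    (hl : ∀ i, 0 ≤ l i) (hr : ∀ i, 0 < r i) :
    ∑ i, l i * r i * (chKL (P i) (chOut P l) - Real.log (r i)) ≤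
      chMI P (fun i => l i * r i) := by
  set q := chOut P l
  set q' := chOut P (fun i => l i * r i)
  have hlr : ∀ i, 0 ≤ l i * r i := fun i => mul_nonneg (hl i) (hr i).le
  have term : ∀ i j, l i * r i * (P i j * (Real.log (P i j / q j) - Real.log (r i))) -
      l i * r i * P i j * Real.log (P i j / q' j) ≤
      l i * P i j * (q' j / q j) - l i * r i * P i j := by
    intro i j
    rcases (hl i).eq_or_lt with h | hi
    · simp [← h]
    rcases (hP i j).eq_or_lt with h | hij
    · simp [← h]
    have hri := hr i
    have hqj : 0 < q j := chOut_pos hP hl hi hij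
    have hqj' : 0 < q' j := chOut_pos hP hlr (mul_pos hi hri) hij
    have hlog := Real.log_le_sub_one_of_pos (div_pos hqj' (mul_pos hqj hri))
    rw [Real.log_div hqj'.ne' (mul_pos hqj hri).ne', Real.log_mul hqj.ne' hri.ne'] at hlog
    rw [Real.log_div hij.ne' hqj.ne', Real.log_div hij.ne' hqj'.ne']
    have hmul := mul_le_mul_of_nonneg_left hlog (mul_pos (mul_pos hi hri) hij).le
    have hrhs : l i * r i * P i j * (q' j / (q j * r i) - 1) =
        l i * P i j * (q' j / q j) - l i * r i * P i j := by
      field_simp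
    linarith
  have col : ∀ j, ∑ i, (l i * P i j * (q' j / q j) - l i * r i * P i j) ≤ 0 := by
    intro j
    have hsum : ∑ i, (l i * P i j * (q' j / q j) - l i * r i * P i j) =
        q j * (q' j / q j) - q' j := by
      rw [Finset.sum_sub_distrib, ← Finset.sum_mul]
      rfl
    rw [hsum]
    rcases eq_or_ne (q j) 0 with h | h
    · simpa [h] using chOut_nonneg hP hlr j
    · rw [mul_div_cancel₀ _ h, sub_self]
  have expand : ∑ i, l i * r i * (chKL (P i) q - Real.log (r i)) =
      ∑ i, ∑ j, l i * r i * (P i j * (Real.log (P i j / q j) - Real.log (r i))) := by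
    refine Finset.sum_congr rfl fun i _ => ?_
    simp only [chKL, ← Finset.mul_sum, mul_sub, Finset.sum_sub_distrib, ← Finset.sum_mul,
      hrow i, one_mul]
  have total := Finset.sum_le_sum fun i (_ : i ∈ Finset.univ) =>
    Finset.sum_le_sum fun j (_ : j ∈ Finset.univ) => term i j
  have rhs_nonpos : ∑ i, ∑ j, (l i * P i j * (q' j / q j) - l i * r i * P i j) ≤ 0 := by
    rw [Finset.sum_comm]
    exact Finset.sum_nonpos fun j _ => col j
  rw [expand, chMI, ← sub_nonpos]
  simp only [Finset.sum_sub_distrib] at total rhs_nonpos ⊢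
  exact total.trans rhs_nonpos

theorem arimoto_partition_pos {m n : ℕ} (P : Matrix (Fin m) (Fin n) ℝ) {l : Fin m → ℝ}
    (hl : l ∈ chSimplex m) : 0 < ∑ k, l k * Real.exp (chKL (P k) (chOut P l)) := by
  obtain ⟨i, hi, hne⟩ := Finset.exists_ne_zero_of_sum_ne_zero (hl.2.trans_ne one_ne_zero)
  exact Finset.sum_pos' (fun k _ => mul_nonneg (hl.1 k) (Real.exp_pos _).le)
    ⟨i, hi, mul_pos ((hl.1 i).lt_of_ne' hne) (Real.exp_pos _)⟩

theorem chAF_mem_chSimplex {m n : ℕ} (P : Matrix (Fin m) (Fin n) ℝ) {l : Fin m → ℝ}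
    (hl : l ∈ chSimplex m) : chAF P l ∈ chSimplex m := by
  have hS := arimoto_partition_pos P hl
  refine ⟨fun i => div_nonneg (mul_nonneg (hl.1 i) (Real.exp_pos _).le) hS.le, ?_⟩
  simp only [chAF]
  rw [← Finset.sum_div, div_self hS.ne']

/-- One step of the Arimoto map reaches mutual information at least the logarithm of its
normalizing constant. -/
theorem log_arimoto_partition_le_chMI {m n : ℕ} {P : Matrix (Fin m) (Fin n) ℝ}
    (hP : ∀ i j, 0 ≤ P i j) (hrow : ∀ i, ∑ j, P i j = 1) {l : Fin m → ℝ}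
    (hl : l ∈ chSimplex m) :
    Real.log (∑ k, l k * Real.exp (chKL (P k) (chOut P l))) ≤ chMI P (chAF P l) := by
  have hS := arimoto_partition_pos P hl
  have hF := (chAF_mem_chSimplex P hl).2
  set S := ∑ k, l k * Real.exp (chKL (P k) (chOut P l))
  have hAF : chAF P l = fun i => l i * (Real.exp (chKL (P i) (chOut P l)) / S) := by
    funext i
    rw [chAF, mul_div_assoc]
  have key := sum_mul_chKL_sub_log_le_chMI hP hrow hl.1
    (r := fun i => Real.exp (chKL (P i) (chOut P l)) / S) fun i => div_pos (Real.exp_pos _) hS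
  rw [← hAF] at key
  rw [hAF] at hF
  simpa only [Real.log_div (Real.exp_ne_zero _) hS.ne', Real.log_exp, sub_sub_cancel,
    ← Finset.sum_mul, hF, one_mul] using key

/-- The equality case of Jensen's inequality for `exp`. -/
theorem eq_of_sum_mul_exp_le {ι : Type*} [Fintype ι] {w d : ι → ℝ} {c : ℝ}
    (hw : ∀ i, 0 ≤ w i) (hw1 : ∑ i, w i = 1) (hd : ∑ i, w i * d i = c)
    (hexp : ∑ i, w i * Real.exp (d i) ≤ Real.exp c) {i : ι} (hi : w i ≠ 0) : d i = c := by
  have nonneg : ∀ k ∈ Finset.univ, 0 ≤ w k * (Real.exp (d k - c) - (d k - c + 1)) :=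
    fun k _ => mul_nonneg (hw k) (sub_nonneg.2 (Real.add_one_le_exp _))
  have total : ∑ k, w k * (Real.exp (d k - c) - (d k - c + 1)) =
      (∑ k, w k * Real.exp (d k)) / Real.exp c - 1 := by
    simp only [Real.exp_sub, mul_sub, mul_add, Finset.sum_sub_distrib, Finset.sum_add_distrib,
      ← mul_div_assoc, ← Finset.sum_div, ← Finset.sum_mul, hd, hw1]
    ring
  have zero : ∑ k, w k * (Real.exp (d k - c) - (d k - c + 1)) = 0 := by
    refine le_antisymm ?_ (Finset.sum_nonneg nonneg)
    rw [total, sub_nonpos]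
    exact (div_le_one (Real.exp_pos c)).2 hexp
  have hz := (mul_eq_zero.1 ((Finset.sum_eq_zero_iff_of_nonneg nonneg).1 zero i
    (Finset.mem_univ i))).resolve_left hi
  by_contra h
  linarith [Real.add_one_lt_exp (sub_ne_zero.2 h)]

/-- **Lemma 2.** The capacity-achieving input distribution is a fixed point of
the Arimoto map. -/
theorem stmt_1 (m n : ℕ) (P : Matrix (Fin m) (Fin n) ℝ)
    (hPnn : ∀ i j, 0 ≤ P i j) (hProw : ∀ i, ∑ j, P i j = 1)
    (hPcol : ∀ j, ∃ i, 0 < P i j)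
    (C : ℝ) (hub : ∀ l ∈ chSimplex m, chMI P l ≤ C)
    (lstar : Fin m → ℝ) (hls : lstar ∈ chSimplex m) (hach : chMI P lstar = C) :
    chAF P lstar = lstar := by
  have hS := arimoto_partition_pos P hls
  have hlog := (log_arimoto_partition_le_chMI hPnn hProw hls).trans
    (hub _ (chAF_mem_chSimplex P hls))
  have hD : ∀ i, lstar i ≠ 0 → chKL (P i) (chOut P lstar) = C := fun i hi =>
    eq_of_sum_mul_exp_le hls.1 hls.2 ((chMI_eq_sum_chKL P lstar).symm.trans hach)
      ((Real.log_le_iff_le_exp hS).1 hlog) hi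
  have hterm : ∀ i, lstar i * Real.exp (chKL (P i) (chOut P lstar)) =
      lstar i * Real.exp C := by
    intro i
    rcases eq_or_ne (lstar i) 0 with h | h
    · simp [h]
    · rw [hD i h]
  funext i
  simp only [chAF, hterm]
  rw [← Finset.sum_mul, hls.2, one_mul, mul_div_cancel_right₀ _ (Real.exp_ne_zero C)]
end
end

section
/- Let λ* ∈ Δ(X) achieve the channel capacity C, with Q* = λ*Φ and Q*_j > 0 for all j. Write D_k(λ) = D(P^k‖λΦ) and D*_{i'} = D(P^{i'}‖Q*). Then, treating λ_1,…,λ_m as independent variables on the open set U = {λ ∈ ℝ^m : (λΦ)_j > 0 for all j}, for each i' ∈ {1,…,m}: ∂/∂λ_{i'} [Σ_{k=1}^m λ_k exp(D_k(λ))] evaluated at λ = λ* equals exp(D*_{i'}) − exp(C). (Lemma 3, eq. (lem3-3)) -/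
open scoped BigOperators

noncomputable section

/-- The output probability `(λΦ)_j` as a continuous linear form in `λ`. -/
def chOutCLM {m n : ℕ} (P : Matrix (Fin m) (Fin n) ℝ) (j : Fin n) : (Fin m → ℝ) →L[ℝ] ℝ :=
  ∑ i, P i j • ContinuousLinearMap.proj i

lemma chOutCLM_apply {m n : ℕ} (P : Matrix (Fin m) (Fin n) ℝ) (j : Fin n) (x : Fin m → ℝ) :
    chOutCLM P j x = chOut P x j := by
  simp [chOutCLM, chOut, mul_comm]

lemma chOut_single {m n : ℕ} (P : Matrix (Fin m) (Fin n) ℝ) (i : Fin m) (j : Fin n) :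
    chOut P (Pi.single i 1) j = P i j := by
  simp [chOut, Pi.single_apply]

lemma sum_chOut {m n : ℕ} {P : Matrix (Fin m) (Fin n) ℝ} (hProw : ∀ i, ∑ j, P i j = 1)
    (x : Fin m → ℝ) : ∑ j, chOut P x j = ∑ i, x i := by
  simp only [chOut]
  rw [Finset.sum_comm]
  simp [← Finset.mul_sum, hProw]

lemma chMI_eq_sum_mul_chKL {m n : ℕ} (P : Matrix (Fin m) (Fin n) ℝ) (x : Fin m → ℝ) :
    chMI P x = ∑ k, x k * chKL (P k) (chOut P x) := by
  simp [chMI, chKL, Finset.mul_sum, mul_assoc]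

lemma hasFDerivAt_chOut {m n : ℕ} (P : Matrix (Fin m) (Fin n) ℝ) (j : Fin n) (x : Fin m → ℝ) :
    HasFDerivAt (fun y => chOut P y j) (chOutCLM P j) x := by
  have h := (chOutCLM P j).hasFDerivAt (x := x)
  rwa [show ⇑(chOutCLM P j) = fun y => chOut P y j from funext (chOutCLM_apply P j)] at h

/-- The gradient of `λ ↦ D(Q‖λΦ)`. -/
lemma hasFDerivAt_chKL_chOut {m n : ℕ} (P : Matrix (Fin m) (Fin n) ℝ) (Q : Fin n → ℝ)
    {x : Fin m → ℝ} (hx : ∀ j, 0 < chOut P x j) :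
    HasFDerivAt (fun y => chKL Q (chOut P y))
      (∑ j, (-(Q j / chOut P x j)) • chOutCLM P j) x := by
  unfold chKL
  refine HasFDerivAt.fun_sum fun j _ => ?_
  by_cases hQ : Q j = 0
  · simpa [hQ] using hasFDerivAt_const (0 : ℝ) x
  have hlog := (((hasFDerivAt_chOut P j x).log (hx j).ne').const_sub
    (Real.log (Q j))).const_mul (Q j)
  have hcont : ∀ᶠ y in nhds x, 0 < chOut P y j :=
    (hasFDerivAt_chOut P j x).continuousAt.eventually (lt_mem_nhds (hx j))
  refine (hlog.congr_of_eventuallyEq ?_).congr_fderiv ?_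
  · filter_upwards [hcont] with y hy
    rw [Real.log_div hQ hy.ne']
  · ext v
    simp [div_eq_mul_inv, mul_assoc]

/-- Averaging the gradients of the divergences `D(P^k‖λΦ)` with weights `λ_k`. -/
lemma sum_mul_chOut_eq {m n : ℕ} {P : Matrix (Fin m) (Fin n) ℝ} (hProw : ∀ i, ∑ j, P i j = 1)
    {x : Fin m → ℝ} (hx : ∀ j, 0 < chOut P x j) (v : Fin m → ℝ) :
    ∑ k, x k * ∑ j, P k j / chOut P x j * chOut P v j = ∑ i, v i := by
  rw [← sum_chOut hProw v]
  simp only [Finset.mul_sum]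
  rw [Finset.sum_comm]
  refine Finset.sum_congr rfl fun j _ => ?_
  calc ∑ k, x k * (P k j / chOut P x j * chOut P v j)
      = (∑ k, x k * P k j) * (chOut P v j / chOut P x j) := by
        rw [Finset.sum_mul]
        exact Finset.sum_congr rfl fun k _ => by ring
    _ = chOut P x j * (chOut P v j / chOut P x j) := rfl
    _ = chOut P v j := mul_div_cancel₀ _ (hx j).ne'

lemma single_mem_chSimplex {m : ℕ} (i : Fin m) : (Pi.single i 1 : Fin m → ℝ) ∈ chSimplex m :=
  single_mem_stdSimplex ℝ i

/-- One half of the Kuhn–Tucker condition: every row is within divergence `C` of the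
capacity-achieving output distribution. -/
lemma chKL_le_of_isMax {m n : ℕ} {P : Matrix (Fin m) (Fin n) ℝ} (hProw : ∀ i, ∑ j, P i j = 1)
    {l : Fin m → ℝ} (hl : l ∈ chSimplex m) (hmax : ∀ x ∈ chSimplex m, chMI P x ≤ chMI P l)
    (hpos : ∀ j, 0 < chOut P l j) (i : Fin m) :
    chKL (P i) (chOut P l) ≤ chMI P l := by
  have hderiv := HasFDerivAt.fun_sum (u := Finset.univ) fun (k : Fin m) _ =>
    (hasFDerivAt_apply (𝕜 := ℝ) (F' := fun _ : Fin m => ℝ) k l).mul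
      (hasFDerivAt_chKL_chOut P (P k) hpos)
  have hmaxOn : IsLocalMaxOn (fun y => ∑ k, y k * chKL (P k) (chOut P y)) (chSimplex m) l := by
    refine IsMaxOn.localize fun x hx => ?_
    simpa only [Set.mem_ofPred_eq, chMI_eq_sum_mul_chKL] using hmax x hx
  have hcone : Pi.single i 1 - l ∈ posTangentConeAt (chSimplex m) l :=
    sub_mem_posTangentConeAt_of_segment_subset
      ((convex_stdSimplex ℝ (Fin m)).segment_subset hl (single_mem_chSimplex i))
  have hle := hmaxOn.hasFDerivWithinAt_nonpos hderiv.hasFDerivWithinAt hcone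
  have hsum := sum_mul_chOut_eq hProw hpos (Pi.single i 1 - l)
  have hzero : ∑ k, (Pi.single i 1 - l : Fin m → ℝ) k = 0 := by
    simp [hl.2]
  have hlin : ∑ k, (Pi.single i 1 - l : Fin m → ℝ) k * chKL (P k) (chOut P l)
      = chKL (P i) (chOut P l) - chMI P l := by
    simp [sub_mul, Finset.sum_sub_distrib, Pi.single_apply, chMI_eq_sum_mul_chKL]
  rw [hzero] at hsum
  simp only [sum_apply, add_apply,
    smul_apply, ContinuousLinearMap.proj_apply, chOutCLM_apply,
    smul_eq_mul, neg_mul, Finset.sum_neg_distrib, mul_neg, Finset.sum_add_distrib, hsum] at hle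
  simp only [mul_comm (chKL _ _)] at hle
  linarith

/-- The other half of the Kuhn–Tucker condition: equality on the support of `λ*`. -/
lemma chKL_eq_of_isMax {m n : ℕ} {P : Matrix (Fin m) (Fin n) ℝ} (hProw : ∀ i, ∑ j, P i j = 1)
    {l : Fin m → ℝ} (hl : l ∈ chSimplex m) (hmax : ∀ x ∈ chSimplex m, chMI P x ≤ chMI P l)
    (hpos : ∀ j, 0 < chOut P l j) {i : Fin m} (hi : l i ≠ 0) :
    chKL (P i) (chOut P l) = chMI P l := by
  have hle : ∀ k ∈ Finset.univ, l k * chKL (P k) (chOut P l) ≤ l k * chMI P l := fun k _ =>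
    mul_le_mul_of_nonneg_left (chKL_le_of_isMax hProw hl hmax hpos k) (hl.1 k)
  have hsum : ∑ k, l k * chKL (P k) (chOut P l) = ∑ k, l k * chMI P l := by
    rw [← Finset.sum_mul, hl.2, one_mul, chMI_eq_sum_mul_chKL]
  exact mul_left_cancel₀ hi ((Finset.sum_eq_sum_iff_of_le hle).1 hsum i (Finset.mem_univ i))

/-- **Lemma 3, eq. (lem3-3).** At the capacity-achieving distribution `λ*`,
`∂/∂λ_{i'} [Σ_k λ_k exp(D_k(λ))] |_{λ=λ*} = exp(D*_{i'}) − exp(C)`. -/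
theorem stmt_4 (m n : ℕ) (P : Matrix (Fin m) (Fin n) ℝ)
    (hPnn : ∀ i j, 0 ≤ P i j) (hProw : ∀ i, ∑ j, P i j = 1)
    (hPcol : ∀ j, ∃ i, 0 < P i j)
    (C : ℝ) (hub : ∀ l ∈ chSimplex m, chMI P l ≤ C)
    (lstar : Fin m → ℝ) (hls : lstar ∈ chSimplex m) (hach : chMI P lstar = C)
    (hQpos : ∀ j, 0 < chOut P lstar j) (i' : Fin m) :
    chPd (fun x => ∑ k, x k * Real.exp (chKL (P k) (chOut P x))) i' lstar
      = Real.exp (chKL (P i') (chOut P lstar)) - Real.exp C := by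
  have hderiv := HasFDerivAt.fun_sum (u := Finset.univ) fun (k : Fin m) _ =>
    (hasFDerivAt_apply (𝕜 := ℝ) (F' := fun _ : Fin m => ℝ) k lstar).mul
      (hasFDerivAt_chKL_chOut P (P k) hQpos).exp
  have hexp : ∀ k, lstar k * Real.exp (chKL (P k) (chOut P lstar)) = lstar k * Real.exp C := by
    intro k
    by_cases hk : lstar k = 0
    · simp [hk]
    · rw [chKL_eq_of_isMax hProw hls (hach ▸ hub) hQpos hk, hach]
  have hsum := sum_mul_chOut_eq hProw hQpos (Pi.single i' 1)
  have hone : ∑ k, (Pi.single i' 1 : Fin m → ℝ) k = 1 := by simp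
  unfold chPd
  refine (congrArg (fun L : (Fin m → ℝ) →L[ℝ] ℝ => L (Pi.single i' 1)) hderiv.fderiv).trans ?_
  simp only [sum_apply, add_apply,
    smul_apply, ContinuousLinearMap.proj_apply, chOutCLM_apply,
    smul_eq_mul, neg_mul, Finset.sum_neg_distrib, mul_neg, Finset.sum_add_distrib,
    ← mul_assoc, hexp]
  simp only [mul_right_comm _ (Real.exp C), ← Finset.sum_mul, hsum, hone]
  simp [Pi.single_apply, neg_add_eq_sub]
end
end

section
/- Let m₁ ≤ n, let Φ₁ be the m₁×n real matrix whose rows P^1,…,P^{m₁} are probability vectors on {1,…,n}, with rank Φ₁ = m₁. Let λ*_1,…,λ*_{m₁} > 0 with Σ_{i=1}^{m₁} λ*_i = 1 and suppose Q*_j = Σ_{i=1}^{m₁} λ*_i P^i_j > 0 for all j. Define the m₁×m₁ matrix J^I with entries J^I_{i'i} = δ_{i'i} − λ*_i Σ_{j=1}^n P^{i'}_j P^i_j / Q*_j. Then every (complex) eigenvalue θ of J^I is real and satisfies 0 ≤ θ < 1. (Theorem 2) -/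
open scoped BigOperators

noncomputable section

/-- A row combination of a real matrix of full row rank vanishes only trivially. -/
theorem eq_zero_of_sum_mul_eq_zero_of_rank_eq {m n : ℕ} (P : Matrix (Fin m) (Fin n) ℝ)
    (hrank : P.rank = m) (c : Fin m → ℝ) (hc : ∀ j, ∑ i, c i * P i j = 0) : c = 0 := by
  have hli : LinearIndependent ℝ P.row := by
    rw [linearIndependent_iff_card_eq_finrank_span, Set.finrank,
      ← Matrix.rank_eq_finrank_span_row, hrank, Fintype.card_fin]
  rw [Fintype.linearIndependent_iff] at hli
  funext i
  refine hli c ?_ i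
  funext j
  simpa [Finset.sum_apply, Matrix.row] using hc j

/-- The complex version of `eq_zero_of_sum_mul_eq_zero_of_rank_eq`. -/
theorem eq_zero_of_complex_sum_mul_eq_zero_of_rank_eq {m n : ℕ} (P : Matrix (Fin m) (Fin n) ℝ)
    (hrank : P.rank = m) (c : Fin m → ℂ) (hc : ∀ j, ∑ i, c i * (P i j : ℂ) = 0) : c = 0 := by
  have hre := eq_zero_of_sum_mul_eq_zero_of_rank_eq P hrank (fun i => (c i).re) fun j => by
    simpa using congrArg Complex.re (hc j)
  have him := eq_zero_of_sum_mul_eq_zero_of_rank_eq P hrank (fun i => (c i).im) fun j => by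
    simpa using congrArg Complex.im (hc j)
  funext i
  exact Complex.ext (congrFun hre i) (congrFun him i)

/-- Cauchy–Schwarz for a weighted sum of complex numbers with nonnegative weights. -/
theorem normSq_sum_mul_le {ι : Type*} [Fintype ι] (w : ι → ℝ) (hw : ∀ i, 0 ≤ w i) (x : ι → ℂ) :
    Complex.normSq (∑ i, (w i : ℂ) * x i) ≤ (∑ i, w i) * ∑ i, w i * Complex.normSq (x i) := by
  have hle : ‖∑ i, (w i : ℂ) * x i‖ ≤ ∑ i, w i * ‖x i‖ := by
    refine (norm_sum_le _ _).trans_eq (Finset.sum_congr rfl fun i _ => ?_)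
    rw [norm_mul, Complex.norm_real, Real.norm_of_nonneg (hw i)]
  simp only [Complex.normSq_eq_norm_sq]
  refine (pow_le_pow_left₀ (norm_nonneg _) hle 2).trans ?_
  exact Finset.sum_sq_le_sum_mul_sum_of_sq_le_mul _ (fun i _ => hw i)
    (fun i _ => mul_nonneg (hw i) (sq_nonneg _)) fun i _ => le_of_eq (by ring)

/-- **Theorem 2.** Every complex eigenvalue `θ` of the matrix
`J^I_{i'i} = δ_{i'i} − λ*_i Σ_j P^{i'}_j P^i_j / Q*_j` is real and satisfies
`0 ≤ θ < 1`. -/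
theorem stmt_7 (m₁ n : ℕ) (hmn : m₁ ≤ n) (Φ₁ : Matrix (Fin m₁) (Fin n) ℝ)
    (hnn : ∀ i j, 0 ≤ Φ₁ i j) (hrow : ∀ i, ∑ j, Φ₁ i j = 1)
    (hrank : Φ₁.rank = m₁)
    (l : Fin m₁ → ℝ) (hl : ∀ i, 0 < l i) (hsum : ∑ i, l i = 1)
    (Q : Fin n → ℝ) (hQ : ∀ j, Q j = ∑ i, l i * Φ₁ i j) (hQpos : ∀ j, 0 < Q j)
    (J : Matrix (Fin m₁) (Fin m₁) ℝ)
    (hJ : ∀ i' i, J i' i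
      = (if i' = i then (1 : ℝ) else 0) - l i * ∑ j, Φ₁ i' j * Φ₁ i j / Q j) :
    ∀ θ ∈ spectrum ℂ (J.map fun x => (x : ℂ)), θ.im = 0 ∧ 0 ≤ θ.re ∧ θ.re < 1 := by
  intro θ hθ
  rw [← Matrix.spectrum_toLin', ← Module.End.hasEigenvalue_iff_mem_spectrum] at hθ
  obtain ⟨x, hx⟩ := hθ.exists_hasEigenvector
  have hx0 : x ≠ 0 := hx.2
  have hev := hx.apply_eq_smul
  rw [Matrix.toLin'_apply] at hev
  set y : Fin n → ℂ := fun j => ∑ i, ((l i * Φ₁ i j : ℝ) : ℂ) * x i with hy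
  set N : ℝ := ∑ i, l i * Complex.normSq (x i) with hN
  set S : ℝ := ∑ j, Complex.normSq (y j) / Q j with hS
  have hrow_eq : ∀ k, (1 - θ) * x k = ∑ j, (Φ₁ k j : ℂ) * y j / (Q j : ℂ) := by
    intro k
    have hk : ∑ i, ((J k i : ℝ) : ℂ) * x i = θ * x k := by
      simpa [Matrix.mulVec, dotProduct] using congrFun hev k
    have hJk : ∑ i, ((J k i : ℝ) : ℂ) * x i
        = x k - ∑ j, (Φ₁ k j : ℂ) * y j / (Q j : ℂ) := by
      have hdelta : x k = ∑ i, (if k = i then (1 : ℂ) else 0) * x i := by simp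
      have hswap : ∑ j, (Φ₁ k j : ℂ) * y j / (Q j : ℂ)
          = ∑ i, ((l i * ∑ j, Φ₁ k j * Φ₁ i j / Q j : ℝ) : ℂ) * x i := by
        simp only [hy, Finset.mul_sum, Finset.sum_div, Complex.ofReal_sum, Finset.sum_mul]
        rw [Finset.sum_comm]
        refine Finset.sum_congr rfl fun i _ => Finset.sum_congr rfl fun j _ => ?_
        push_cast
        ring
      rw [hswap]
      conv_rhs => rw [hdelta]
      rw [← Finset.sum_sub_distrib]
      refine Finset.sum_congr rfl fun i _ => ?_
      rw [hJ, ← sub_mul, Complex.ofReal_sub]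
      split_ifs <;> simp
    rw [sub_mul, one_mul, ← hk, hJk]
    ring
  have hquad : (1 - θ) * (N : ℂ) = (S : ℂ) := by
    have hleft : (1 - θ) * (N : ℂ)
        = ∑ k, (l k : ℂ) * (starRingEnd ℂ) (x k) * ((1 - θ) * x k) := by
      rw [hN, Complex.ofReal_sum, Finset.mul_sum]
      refine Finset.sum_congr rfl fun k _ => ?_
      rw [Complex.ofReal_mul, Complex.normSq_eq_conj_mul_self]
      ring
    rw [hleft, hS, Complex.ofReal_sum]
    simp only [hrow_eq, Finset.mul_sum]
    rw [Finset.sum_comm]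
    refine Finset.sum_congr rfl fun j _ => ?_
    have hconj : (starRingEnd ℂ) (y j)
        = ∑ k, ((l k * Φ₁ k j : ℝ) : ℂ) * (starRingEnd ℂ) (x k) := by
      simp only [hy, map_sum, map_mul, Complex.conj_ofReal]
    rw [Complex.ofReal_div, Complex.normSq_eq_conj_mul_self, hconj, Finset.sum_mul,
      Finset.sum_div]
    refine Finset.sum_congr rfl fun k _ => ?_
    push_cast
    ring
  have hNpos : 0 < N := by
    obtain ⟨i, hi⟩ := Function.ne_iff.mp hx0
    exact Finset.sum_pos' (fun i _ => mul_nonneg (hl i).le (Complex.normSq_nonneg _))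
      ⟨i, Finset.mem_univ i, mul_pos (hl i) (Complex.normSq_pos.mpr hi)⟩
  have hSpos : 0 < S := by
    have hy0 : ∃ j, y j ≠ 0 := by
      by_contra! h
      have hc := eq_zero_of_complex_sum_mul_eq_zero_of_rank_eq Φ₁ hrank
        (fun i => (l i : ℂ) * x i) fun j => by
          rw [← h j]
          refine Finset.sum_congr rfl fun i _ => ?_
          push_cast
          ring
      refine hx0 (funext fun i => ?_)
      have hi : (l i : ℂ) * x i = 0 := congrFun hc i
      exact (mul_eq_zero.mp hi).resolve_left (Complex.ofReal_ne_zero.mpr (hl i).ne')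
    obtain ⟨j, hj⟩ := hy0
    exact Finset.sum_pos' (fun j _ => div_nonneg (Complex.normSq_nonneg _) (hQpos j).le)
      ⟨j, Finset.mem_univ j, div_pos (Complex.normSq_pos.mpr hj) (hQpos j)⟩
  have hSN : S ≤ N := by
    have hterm : ∀ j, Complex.normSq (y j) / Q j
        ≤ ∑ i, l i * Φ₁ i j * Complex.normSq (x i) := fun j => by
      rw [div_le_iff₀' (hQpos j), hQ j]
      exact normSq_sum_mul_le _ (fun i => mul_nonneg (hl i).le (hnn i j)) x
    refine (Finset.sum_le_sum fun j _ => hterm j).trans_eq ?_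
    rw [Finset.sum_comm]
    refine Finset.sum_congr rfl fun i _ => ?_
    rw [← Finset.sum_mul, ← Finset.mul_sum, hrow, mul_one]
  have hre : (1 - θ.re) * N = S := by simpa using congrArg Complex.re hquad
  have him : θ.im = 0 := by
    have h := congrArg Complex.im hquad
    simpa [hNpos.ne'] using h
  exact ⟨him, by nlinarith, by nlinarith⟩
end
end

section
/- Let P^1 and P^2 be probability vectors on {1,…,n} with P^1 ≠ P^2, let λ*_1, λ*_2 > 0 with λ*_1 + λ*_2 = 1, and set Q* = λ*_1 P^1 + λ*_2 P^2; assume Q*_j > 0 for all j. Then Σ_{j=1}^n (P^2_j)² / Q*_j > Σ_{j=1}^n P^1_j P^2_j / Q*_j. (Key inequality (lem1-1) in the proof of Lemma 4) -/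
open scoped BigOperators

/-- **Key inequality (lem1-1) in the proof of Lemma 4.**
`Σ_j (P²_j)²/Q*_j > Σ_j P¹_j P²_j / Q*_j`. -/
theorem stmt_11 (n : ℕ) (P1 P2 : Fin n → ℝ)
    (hP1nn : ∀ j, 0 ≤ P1 j) (hP1sum : ∑ j, P1 j = 1)
    (hP2nn : ∀ j, 0 ≤ P2 j) (hP2sum : ∑ j, P2 j = 1)
    (hne : P1 ≠ P2)
    (l1 l2 : ℝ) (hl1 : 0 < l1) (hl2 : 0 < l2) (hsum : l1 + l2 = 1)
    (Q : Fin n → ℝ) (hQ : ∀ j, Q j = l1 * P1 j + l2 * P2 j)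
    (hQpos : ∀ j, 0 < Q j) :
    ∑ j, P1 j * P2 j / Q j < ∑ j, (P2 j) ^ 2 / Q j := by
  have hterm : ∀ j, (P2 j) ^ 2 / Q j =
      P1 j * P2 j / Q j + (P2 j - P1 j) + l1 * ((P2 j - P1 j) ^ 2 / Q j) := by
    intro j
    have hQj : Q j ≠ 0 := (hQpos j).ne'
    have hP2 : P2 j = Q j + l1 * (P2 j - P1 j) := by
      rw [hQ j]
      linear_combination (-P2 j) * hsum
    field_simp
    linear_combination (P2 j - P1 j) * hP2
  have hpos : 0 < ∑ j, (P2 j - P1 j) ^ 2 / Q j := by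
    obtain ⟨i, hi⟩ := Function.ne_iff.mp hne
    refine Finset.sum_pos' (fun j _ => div_nonneg (sq_nonneg _) (hQpos j).le)
      ⟨i, Finset.mem_univ i, ?_⟩
    exact div_pos (sq_pos_of_ne_zero (sub_ne_zero.mpr hi.symm)) (hQpos i)
  rw [Finset.sum_congr rfl fun j _ => hterm j, Finset.sum_add_distrib, Finset.sum_add_distrib,
    Finset.sum_sub_distrib, hP1sum, hP2sum, ← Finset.mul_sum]
  linarith [mul_pos hl1 hpos]
end

section
/- Let P^1, P^2, P^3 be probability vectors on {1,…,n}, let λ*_1, λ*_2 > 0 with λ*_1 + λ*_2 = 1, set Q* = λ*_1 P^1 + λ*_2 P^2 and assume Q*_j > 0 for all j. Define D*_{i',i} = −Σ_{j=1}^n P^{i'}_j P^i_j / Q*_j. Then the characteristic polynomial of the 2×2 matrix Ĵ = [[1 + λ*_1 D*_{1,1} − λ*_1 D*_{1,3}, λ*_2 D*_{1,2} − λ*_2 D*_{2,3}], [λ*_1 D*_{1,2} − λ*_1 D*_{1,3}, 1 + λ*_2 D*_{2,2} − λ*_2 D*_{2,3}]] equals (η + D*_{1,2})(η − 1); in particular,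 the eigenvalues of Ĵ are −D*_{1,2} and 1. (Computation in Section 7.1) -/
open scoped BigOperators

/-- Pairing `A` with the mixture `Q = l1 P1 + l2 P2` under the weight `1 / Q` returns the mass
of `A`. -/
theorem mixture_pairing_sum {ι : Type*} [Fintype ι] (P1 P2 Q A : ι → ℝ) (l1 l2 : ℝ)
    (hQ : ∀ j, Q j = l1 * P1 j + l2 * P2 j) (hQ0 : ∀ j, Q j ≠ 0) :
    l1 * ∑ j, P1 j * A j / Q j + l2 * ∑ j, P2 j * A j / Q j = ∑ j, A j := by
  rw [Finset.mul_sum, Finset.mul_sum, ← Finset.sum_add_distrib]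
  refine Finset.sum_congr rfl fun j _ => ?_
  have h := hQ0 j
  field_simp
  rw [hQ j]

/-- A real scalar lies in the spectrum of a matrix iff it is a root of the characteristic
determinant. -/
theorem mem_spectrum_iff_det_sub_smul_one_eq_zero {m : Type*} [Fintype m] [DecidableEq m]
    (M : Matrix m m ℝ) (r : ℝ) :
    r ∈ spectrum ℝ M ↔ (M - r • (1 : Matrix m m ℝ)).det = 0 := by
  rw [spectrum.mem_iff, Algebra.algebraMap_eq_smul_one, ← neg_sub M, IsUnit.neg_iff,
    Matrix.isUnit_iff_isUnit_det, isUnit_iff_ne_zero, not_not]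

/-- **Computation in Section 7.1.** The characteristic polynomial of the 2×2
matrix `Ĵ` equals `(η + D*_{1,2})(η − 1)`; in particular its eigenvalues are
`−D*_{1,2}` and `1`. -/
theorem stmt_13 (n : ℕ) (P1 P2 P3 : Fin n → ℝ)
    (hP1nn : ∀ j, 0 ≤ P1 j) (hP1sum : ∑ j, P1 j = 1)
    (hP2nn : ∀ j, 0 ≤ P2 j) (hP2sum : ∑ j, P2 j = 1)
    (hP3nn : ∀ j, 0 ≤ P3 j) (hP3sum : ∑ j, P3 j = 1)
    (l1 l2 : ℝ) (hl1 : 0 < l1) (hl2 : 0 < l2) (hsum : l1 + l2 = 1)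
    (Q : Fin n → ℝ) (hQ : ∀ j, Q j = l1 * P1 j + l2 * P2 j)
    (hQpos : ∀ j, 0 < Q j)
    (D : (Fin n → ℝ) → (Fin n → ℝ) → ℝ)
    (hD : ∀ A B, D A B = -∑ j, A j * B j / Q j)
    (Jhat : Matrix (Fin 2) (Fin 2) ℝ)
    (hJhat : Jhat =
      !![1 + l1 * D P1 P1 - l1 * D P1 P3, l2 * D P1 P2 - l2 * D P2 P3;
         l1 * D P1 P2 - l1 * D P1 P3, 1 + l2 * D P2 P2 - l2 * D P2 P3]) :
    (∀ η : ℝ, (Jhat - η • (1 : Matrix (Fin 2) (Fin 2) ℝ)).det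
        = (η + D P1 P2) * (η - 1)) ∧
      spectrum ℝ Jhat = {-(D P1 P2), 1} := by
  have key : ∀ A : Fin n → ℝ, ∑ j, A j = 1 → l1 * D P1 A + l2 * D P2 A = -1 := by
    intro A hA
    have h := mixture_pairing_sum P1 P2 Q A l1 l2 hQ fun j => (hQpos j).ne'
    rw [hD, hD]
    linarith
  have hsymm : D P2 P1 = D P1 P2 := by simp only [hD, mul_comm]
  have h1 := key P1 hP1sum
  have h2 := key P2 hP2sum
  have h3 := key P3 hP3sum
  rw [hsymm] at h1
  have hdet : ∀ η : ℝ, (Jhat - η • (1 : Matrix (Fin 2) (Fin 2) ℝ)).det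
      = (η + D P1 P2) * (η - 1) := by
    intro η
    have e1 : l1 * D P1 P1 = -1 - l2 * D P1 P2 := by linarith
    have e2 : l2 * D P2 P2 = -1 - l1 * D P1 P2 := by linarith
    have e3 : l2 * D P2 P3 = -1 - l1 * D P1 P3 := by linarith
    have e4 : l2 = 1 - l1 := by linarith
    rw [hJhat, Matrix.det_fin_two]
    simp [e1, e2, e3]
    rw [e4]
    ring
  refine ⟨hdet, ?_⟩
  ext η
  rw [mem_spectrum_iff_det_sub_smul_one_eq_zero, hdet, mul_eq_zero, add_eq_zero_iff_eq_neg,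
    sub_eq_zero, Set.mem_insert_iff, Set.mem_singleton_iff]
end

section
/- Let ρ > 0 and let r : ℝ → ℝ satisfy r(x) = o(x²) as x → 0 (i.e., r(x)/x² → 0 as x → 0). Then there exists δ > 0 such that for every initial value μ^0 with 0 < μ^0 < δ, the sequence defined by μ^{N+1} = μ^N − ρ (μ^N)² + r(μ^N) satisfies 0 < μ^N < δ for all N and lim_{N→∞} μ^N = 0. (Lemma 5) -/
/-- A positive sequence with quadratic decrease `c * u n ^ 2 ≤ u n - u (n + 1)` tends to `0`. -/
theorem tendsto_zero_of_quadratic_decrease {c : ℝ} (hc : 0 < c) {u : ℕ → ℝ}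
    (hpos : ∀ n, 0 < u n) (hdec : ∀ n, u (n + 1) ≤ u n - c * u n ^ 2) :
    Filter.Tendsto u Filter.atTop (nhds 0) := by
  have hanti : Antitone u := antitone_nat_of_succ_le fun n =>
    (hdec n).trans (sub_le_self _ (by positivity))
  have hbdd : BddBelow (Set.range u) := ⟨0, by rintro _ ⟨n, rfl⟩; exact (hpos n).le⟩
  have hlim := tendsto_atTop_ciInf hanti hbdd
  have hle := le_of_tendsto_of_tendsto' (hlim.comp (Filter.tendsto_add_atTop_nat 1))
    (hlim.sub ((hlim.pow 2).const_mul c)) hdec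
  have hsq : (⨅ n, u n) ^ 2 = 0 := by
    refine le_antisymm ?_ (sq_nonneg _)
    by_contra! h
    linarith [mul_pos hc h]
  rwa [pow_eq_zero_iff two_ne_zero |>.mp hsq] at hlim

/-- **Lemma 5.** For `ρ > 0` and `r(x) = o(x²)` as `x → 0`, there is `δ > 0`
such that for any initial value `0 < μ⁰ < δ` the sequence
`μ^{N+1} = μ^N − ρ(μ^N)² + r(μ^N)` stays in `(0, δ)` and converges to `0`. -/
theorem stmt_15 (ρ : ℝ) (hρ : 0 < ρ) (r : ℝ → ℝ)
    (hr : ∀ ε > (0 : ℝ), ∃ η > (0 : ℝ), ∀ x : ℝ, 0 < |x| → |x| < η →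
      |r x| ≤ ε * x ^ 2) :
    ∃ δ > (0 : ℝ), ∀ μ : ℕ → ℝ, 0 < μ 0 → μ 0 < δ →
      (∀ N, μ (N + 1) = μ N - ρ * (μ N) ^ 2 + r (μ N)) →
      (∀ N, 0 < μ N ∧ μ N < δ) ∧ Filter.Tendsto μ Filter.atTop (nhds 0) := by
  obtain ⟨η, hη, hrη⟩ := hr (ρ / 2) (by positivity)
  refine ⟨min η (1 / (2 * ρ)), by positivity, fun μ h0 h0δ hrec => ?_⟩
  have hbound : ∀ x, 0 < x → x < min η (1 / (2 * ρ)) →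
      0 < x - ρ * x ^ 2 + r x ∧ x - ρ * x ^ 2 + r x ≤ x - ρ / 2 * x ^ 2 := by
    intro x hx hxδ
    obtain ⟨hxη, hxρ⟩ := lt_min_iff.mp hxδ
    rw [lt_div_iff₀ (by positivity)] at hxρ
    have habs := abs_le.mp (hrη x (abs_pos.mpr hx.ne') (by rwa [abs_of_pos hx]))
    have hfac : 0 < x * (1 - 3 / 2 * (ρ * x)) := mul_pos hx (by linarith)
    constructor
    · linarith [habs.1]
    · linarith [habs.2]
  have hmem : ∀ N, 0 < μ N ∧ μ N < min η (1 / (2 * ρ)) := by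
    intro N
    induction N with
    | zero => exact ⟨h0, h0δ⟩
    | succ N ih =>
      obtain ⟨hpos, hle⟩ := hbound _ ih.1 ih.2
      rw [hrec N]
      exact ⟨hpos, (hle.trans (sub_le_self _ (by positivity))).trans_lt ih.2⟩
  refine ⟨hmem, tendsto_zero_of_quadratic_decrease (half_pos hρ) (fun N => (hmem N).1) fun N => ?_⟩
  rw [hrec N]
  exact (hbound _ (hmem N).1 (hmem N).2).2
end

section
/- Let ρ > 0 and let r : ℝ → ℝ satisfy r(x) = o(x²) as x → 0. Then there exists δ > 0 such that for every initial value μ^0 with 0 < μ^0 < δ, the sequence defined by μ^{N+1} = μ^N − ρ (μ^N)² + r(μ^N) satisfies lim_{N→∞} N μ^N = 1/ρ; i.e., the convergence μ^N → 0 is of order 1/N. (Lemma 6) -/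
open Filter Topology

/-- If the increments of `1 / u` converge to a nonzero limit `c`, then `N * u N` converges to
`1 / c`. -/
theorem tendsto_natCast_mul_of_tendsto_inv_sub_inv {u : ℕ → ℝ} {c : ℝ} (hc : c ≠ 0)
    (h : Tendsto (fun N => (u (N + 1))⁻¹ - (u N)⁻¹) atTop (𝓝 c)) :
    Tendsto (fun N : ℕ => (N : ℝ) * u N) atTop (𝓝 (1 / c)) := by
  have hces := h.cesaro
  simp only [Finset.sum_range_sub (fun N => (u N)⁻¹)] at hces
  have hinit : Tendsto (fun N : ℕ => (N : ℝ)⁻¹ * (u 0)⁻¹) atTop (𝓝 (0 * (u 0)⁻¹)) :=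
    tendsto_inv_atTop_nhds_zero_nat.mul_const _
  have hsum := (hces.add hinit).inv₀ (by simpa using hc)
  simpa [mul_sub, mul_comm] using hsum

/-- A positive sequence whose reciprocals increase by at least `c > 0` at each step tends
to zero. -/
theorem tendsto_zero_of_add_le_inv {u : ℕ → ℝ} {c : ℝ} (hc : 0 < c) (hu : ∀ N, 0 < u N)
    (h : ∀ N, (u N)⁻¹ + c ≤ (u (N + 1))⁻¹) : Tendsto u atTop (𝓝 0) := by
  have hlin : ∀ N : ℕ, (N : ℝ) * c ≤ (u N)⁻¹ := by
    intro N
    induction N with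
    | zero => simpa using (hu 0).le
    | succ N ih => push_cast; linarith [h N]
  have hinv : Tendsto (fun N => (u N)⁻¹) atTop atTop :=
    tendsto_atTop_mono hlin (tendsto_natCast_atTop_atTop.atTop_mul_const hc)
  exact hinv.inv_tendsto_atTop.congr fun N => inv_inv (u N)

/-- If `r x = o(x ^ 2)` as `x → 0`, then `r (u N) / u N ^ 2 → 0` for nonvanishing `u → 0`. -/
theorem tendsto_div_sq_of_abs_le_mul_sq {r : ℝ → ℝ}
    (hr : ∀ ε > (0 : ℝ), ∃ η > (0 : ℝ), ∀ x : ℝ, 0 < |x| → |x| < η → |r x| ≤ ε * x ^ 2)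
    {u : ℕ → ℝ} (hu : ∀ N, u N ≠ 0) (hlim : Tendsto u atTop (𝓝 0)) :
    Tendsto (fun N => r (u N) / u N ^ 2) atTop (𝓝 0) := by
  rw [Metric.tendsto_nhds]
  intro ε hε
  obtain ⟨η, hη, hrη⟩ := hr (ε / 2) (half_pos hε)
  filter_upwards [Metric.tendsto_nhds.1 hlim η hη] with N hN
  have hpos : 0 < u N ^ 2 := by have := hu N; positivity
  have hb := hrη (u N) (abs_pos.2 (hu N)) (by simpa using hN)
  rw [dist_zero_right, Real.norm_eq_abs, abs_div, abs_of_pos hpos, div_lt_iff₀ hpos]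
  nlinarith

/-- **Lemma 6.** For `ρ > 0` and `r(x) = o(x²)` as `x → 0`, there is `δ > 0`
such that for any initial value `0 < μ⁰ < δ` the sequence
`μ^{N+1} = μ^N − ρ(μ^N)² + r(μ^N)` satisfies `lim_{N→∞} N μ^N = 1/ρ`:
convergence of order `1/N`. -/
theorem stmt_16 (ρ : ℝ) (hρ : 0 < ρ) (r : ℝ → ℝ)
    (hr : ∀ ε > (0 : ℝ), ∃ η > (0 : ℝ), ∀ x : ℝ, 0 < |x| → |x| < η →
      |r x| ≤ ε * x ^ 2) :
    ∃ δ > (0 : ℝ), ∀ μ : ℕ → ℝ, 0 < μ 0 → μ 0 < δ →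
      (∀ N, μ (N + 1) = μ N - ρ * (μ N) ^ 2 + r (μ N)) →
      Filter.Tendsto (fun N : ℕ => (N : ℝ) * μ N) Filter.atTop (nhds (1 / ρ)) := by
  obtain ⟨η, hη, hrη⟩ := hr (ρ / 2) (half_pos hρ)
  refine ⟨min η (1 / (2 * ρ)), by positivity, fun μ h0 hδ hrec => ?_⟩
  have step : ∀ x, 0 < x → x < min η (1 / (2 * ρ)) →
      0 < x - ρ * x ^ 2 + r x ∧ x - ρ * x ^ 2 + r x ≤ x - ρ / 2 * x ^ 2 := by
    intro x hx hxδ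
    have hb := abs_le.1 (hrη x (abs_pos.2 hx.ne')
      (by rw [abs_of_pos hx]; exact hxδ.trans_le (min_le_left _ _)))
    have hxρ : x * (2 * ρ) < 1 :=
      (lt_div_iff₀ (by positivity)).1 (hxδ.trans_le (min_le_right _ _))
    constructor
    · nlinarith [mul_pos hx (sub_pos.2 hxρ)]
    · linarith
  have hμ : ∀ N, 0 < μ N ∧ μ N < min η (1 / (2 * ρ)) := by
    intro N
    induction N with
    | zero => exact ⟨h0, hδ⟩
    | succ N ih =>
      obtain ⟨hpos, hle⟩ := step _ ih.1 ih.2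
      rw [hrec N]
      have : 0 ≤ ρ / 2 * μ N ^ 2 := by positivity
      exact ⟨hpos, by linarith [ih.2]⟩
  have hne : ∀ N, μ N ≠ 0 := fun N => (hμ N).1.ne'
  have hlim : Tendsto μ atTop (𝓝 0) := by
    refine tendsto_zero_of_add_le_inv (half_pos hρ) (fun N => (hμ N).1) fun N => ?_
    have hx := (hμ N).1
    have hy := (hμ (N + 1)).1
    have hle := (step _ hx (hμ N).2).2
    rw [← hrec N] at hle
    have hmono : μ (N + 1) ≤ μ N := hle.trans (sub_le_self _ (by positivity))
    rw [← sub_nonneg]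
    have key : (μ (N + 1))⁻¹ - ((μ N)⁻¹ + ρ / 2) =
        (μ N - μ (N + 1) - ρ / 2 * (μ N * μ (N + 1))) / (μ N * μ (N + 1)) := by
      field_simp
      ring
    rw [key]
    have : ρ / 2 * (μ N * μ (N + 1)) ≤ ρ / 2 * μ N ^ 2 := by
      rw [sq]; gcongr
    exact div_nonneg (by linarith) (by positivity)
  have hq := tendsto_div_sq_of_abs_le_mul_sq hr hne hlim
  refine tendsto_natCast_mul_of_tendsto_inv_sub_inv hρ.ne' ?_
  have hquot : Tendsto (fun N => (ρ - r (μ N) / μ N ^ 2) /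
      (1 - ρ * μ N + r (μ N) / μ N ^ 2 * μ N)) atTop
      (𝓝 ((ρ - 0) / (1 - ρ * 0 + 0 * 0))) :=
    (hq.const_sub ρ).div (((hlim.const_mul ρ).const_sub 1).add (hq.mul hlim)) (by norm_num)
  have hval : (ρ - 0) / (1 - ρ * 0 + 0 * 0) = ρ := by norm_num
  rw [hval] at hquot
  refine hquot.congr fun N => ?_
  have hx := hne N
  have hy := hne (N + 1)
  have hfac : 1 - ρ * μ N + r (μ N) / μ N ^ 2 * μ N = μ (N + 1) / μ N := by
    rw [hrec N]; field_simp
  have hnum : ρ - r (μ N) / μ N ^ 2 = (μ N - μ (N + 1)) / μ N ^ 2 := by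
    rw [hrec N]; field_simp; ring
  rw [hfac, hnum]
  field_simp
end
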